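/- Let N be a finite type, let J_s be a symmetric real N×N matrix and J_a an antisymmetric real N×N matrix, let ε be a real number and ℏ > 0 a real constant, and let P : ℕ → Matrix N N ℝ satisfy the recursion P_{ℓ+1} = P_ℓ + ε·[J_a, P_ℓ] − ε·[J_s, P_ℓᵀ] for all ℓ. Define the complex matrices ρ_ℓ := (P_ℓ + P_ℓᵀ)/2 − (i/2)·(P_ℓ − P_ℓᵀ) and H := −ℏ·J_s + i·ℏ·J_a. Then: (i) H is Hermitian (equal to its conjugate transpose); (ii) the transposed recursion P_{ℓ+1}ᵀ = P_ℓᵀ + ε·[J_a, P_ℓᵀ] + ε·[J_s, P_ℓ] holds for all ℓ; and (iii) the discrete von Neumann equation i·ℏ·(ρ_{ℓ+1} − ρ_ℓ) = ε·[H, ρ_ℓ] holds for all ℓ. -/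

import Mathlib

open Matrix

/-- Entrywise complexification of a real matrix. -/
noncomputable def matCplx {n : Type*} (M : Matrix n n ℝ) : Matrix n n ℂ :=
  M.map (Complex.ofReal)

theorem matCplx_add {n : Type*} (A B : Matrix n n ℝ) :
    matCplx (A + B) = matCplx A + matCplx B := by
  ext; simp [matCplx]

theorem matCplx_sub {n : Type*} (A B : Matrix n n ℝ) :
    matCplx (A - B) = matCplx A - matCplx B := by
  ext; simp [matCplx]

theorem matCplx_neg {n : Type*} (A : Matrix n n ℝ) : matCplx (-A) = -matCplx A := by
  ext; simp [matCplx]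

theorem matCplx_smul {n : Type*} (c : ℝ) (A : Matrix n n ℝ) :
    matCplx (c • A) = (c : ℂ) • matCplx A := by
  ext; simp [matCplx]

theorem matCplx_mul {n : Type*} [Fintype n] (A B : Matrix n n ℝ) :
    matCplx (A * B) = matCplx A * matCplx B := by
  ext; simp [matCplx, Matrix.mul_apply]

theorem matCplx_conjTranspose {n : Type*} (A : Matrix n n ℝ) :
    (matCplx A)ᴴ = matCplx Aᵀ := by
  ext; simp [matCplx]

/-- with `J_s` symmetric, `J_a` antisymmetric, and
`P_{ℓ+1} = P_ℓ + ε [J_a, P_ℓ] - ε [J_s, P_ℓᵀ]`, the complex matrices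
`ρ_ℓ = (P_ℓ + P_ℓᵀ)/2 - (i/2)(P_ℓ - P_ℓᵀ)` and `H = -ℏ J_s + i ℏ J_a` satisfy:
(i) `H` is Hermitian; (ii) the transposed recursion
`P_{ℓ+1}ᵀ = P_ℓᵀ + ε [J_a, P_ℓᵀ] + ε [J_s, P_ℓ]`; and (iii) the discrete von
Neumann equation `i ℏ (ρ_{ℓ+1} - ρ_ℓ) = ε [H, ρ_ℓ]`. -/
theorem stmt8 {N : Type*} [Fintype N]
    (Js Ja : Matrix N N ℝ) (hJs : Jsᵀ = Js) (hJa : Jaᵀ = -Ja)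
    (ε ℏ : ℝ) (hℏ : 0 < ℏ)
    (P : ℕ → Matrix N N ℝ)
    (hrec : ∀ ℓ, P (ℓ + 1) = P ℓ + ε • (Ja * P ℓ - P ℓ * Ja) -
      ε • (Js * (P ℓ)ᵀ - (P ℓ)ᵀ * Js))
    (ρ : ℕ → Matrix N N ℂ)
    (hρ : ∀ ℓ, ρ ℓ = ((2 : ℂ)⁻¹) • matCplx (P ℓ + (P ℓ)ᵀ) -
      (Complex.I * (2 : ℂ)⁻¹) • matCplx (P ℓ - (P ℓ)ᵀ))
    (H : Matrix N N ℂ)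
    (hH : H = -((ℏ : ℂ) • matCplx Js) + Complex.I • ((ℏ : ℂ) • matCplx Ja)) :
    Hᴴ = H ∧
    (∀ ℓ, (P (ℓ + 1))ᵀ = (P ℓ)ᵀ + ε • (Ja * (P ℓ)ᵀ - (P ℓ)ᵀ * Ja) +
      ε • (Js * P ℓ - P ℓ * Js)) ∧
    (∀ ℓ, (Complex.I * (ℏ : ℂ)) • (ρ (ℓ + 1) - ρ ℓ) = (ε : ℂ) • (H * ρ ℓ - ρ ℓ * H)) := by
  have htrans : ∀ ℓ, (P (ℓ + 1))ᵀ = (P ℓ)ᵀ + ε • (Ja * (P ℓ)ᵀ - (P ℓ)ᵀ * Ja) +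
      ε • (Js * P ℓ - P ℓ * Js) := by
    intro ℓ
    rw [hrec ℓ]
    simp only [transpose_add, transpose_sub, transpose_smul, transpose_mul, transpose_transpose,
      hJs, hJa, mul_neg, neg_mul]
    module
  refine ⟨?_, htrans, fun ℓ => ?_⟩
  · rw [hH]
    simp only [conjTranspose_add, conjTranspose_neg, conjTranspose_smul, matCplx_conjTranspose,
      hJs, hJa, matCplx_neg, RCLike.star_def, Complex.conj_I, Complex.conj_ofReal]
    module
  · rw [hρ, hρ, htrans ℓ, hrec ℓ, hH]
    simp only [matCplx_add, matCplx_sub, matCplx_smul, matCplx_mul, mul_add, add_mul, mul_sub,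
      sub_mul, neg_mul, mul_neg, Matrix.smul_mul, Matrix.mul_smul]
    match_scalars <;> ring_nf <;> simp only [Complex.I_sq] <;> ring
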